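/- Let n ≥ 1 and let Ω₁ and Ω₂ be bounded simply connected complete Reinhardt domains in ℂⁿ. Let H be a complex Hilbert space, Y a complex Banach space, U : B(H) → Y a bounded linear operator, 1 ≤ p < ∞ and λ ≥ ‖U‖. Then L_λ(Ω₂,p,U)/(S(Ω₁,Ω₂)·S(Ω₂,Ω₁)) ≤ L_λ(Ω₁,p,U) ≤ S(Ω₁,Ω₂)·S(Ω₂,Ω₁)·L_λ(Ω₂,p,U). -/

import Mathlib

open scoped ENNReal Pointwise
open Filter

noncomputable section

namespace BohrPaper

/-- The monomial `z^α = z₁^{α₁} ⋯ z_n^{α_n}`. -/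
def mpow {n : ℕ} (z : Fin n → ℂ) (α : Fin n → ℕ) : ℂ := ∏ j, z j ^ α j

/-- A complete Reinhardt domain in `ℂⁿ`: nonempty, open, connected and closed under
componentwise decrease of moduli. -/
def IsCompleteReinhardt {n : ℕ} (Ω : Set (Fin n → ℂ)) : Prop :=
  IsOpen Ω ∧ IsConnected Ω ∧
    ∀ z ∈ Ω, ∀ w : Fin n → ℂ, (∀ j, ‖w j‖ ≤ ‖z j‖) → w ∈ Ω

/-- `S(Ω₁, Ω₂) := inf {s > 0 : Ω₁ ⊆ s·Ω₂}`. -/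
def SRatio {n : ℕ} (Ω₁ Ω₂ : Set (Fin n → ℂ)) : ℝ :=
  sInf {s : ℝ | 0 < s ∧ Ω₁ ⊆ s • Ω₂}

/-- The open unit polydisc `𝔻ⁿ`. -/
def polydisc (n : ℕ) : Set (Fin n → ℂ) := {z | ∀ j, ‖z j‖ < 1}

/-- The sup-norm of `f` over `Ω`. -/
def supNorm {n : ℕ} {E : Type*} [Norm E] (Ω : Set (Fin n → ℂ)) (f : (Fin n → ℂ) → E) : ℝ :=
  ⨆ z ∈ Ω, ‖f z‖

/-- The `ℓ_q`-norm on `ℂⁿ` (`q = ∞` gives the max norm). -/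
def lqNorm (n : ℕ) (q : ℝ≥0∞) (z : Fin n → ℂ) : ℝ :=
  if q = ∞ then ⨆ j, ‖z j‖
  else (∑ j, ‖z j‖ ^ q.toReal) ^ (1 / q.toReal)

/-- The open unit ball of `ℓⁿ_q`. -/
def lqBall (n : ℕ) (q : ℝ≥0∞) : Set (Fin n → ℂ) := {z | lqNorm n q z < 1}

/-- `N` is a norm on `ℂⁿ`. -/
def IsNorm {n : ℕ} (N : (Fin n → ℂ) → ℝ) : Prop :=
  (∀ z, 0 ≤ N z) ∧ (∀ z, N z = 0 → z = 0) ∧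
    (∀ (c : ℂ) (z), N (c • z) = ‖c‖ * N z) ∧ ∀ z w, N (z + w) ≤ N z + N w

/-- The canonical basis of `ℂⁿ` is normalized and 1-unconditional for the norm `N`. -/
def IsNormalized1Unconditional {n : ℕ} (N : (Fin n → ℂ) → ℝ) : Prop :=
  (∀ k, N (fun j => if j = k then 1 else 0) = 1) ∧
    ∀ ε μ : Fin n → ℂ, (∀ j, ‖ε j‖ ≤ 1) → N (fun j => ε j * μ j) ≤ N μ

/-- Open unit ball of the norm `N`. -/
def unitBall {n : ℕ} (N : (Fin n → ℂ) → ℝ) : Set (Fin n → ℂ) := {z | N z < 1}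

/-- Operator norm of the identity map `(ℂⁿ, N₁) → (ℂⁿ, N₂)`. -/
def idNorm {n : ℕ} (N₁ N₂ : (Fin n → ℂ) → ℝ) : ℝ :=
  sInf {c : ℝ | 0 ≤ c ∧ ∀ z, N₂ z ≤ c * N₁ z}

/-- `b_m(Ω) = (inf_{|α| = m} sup_{z ∈ Ω} |z^α|)^{-1/m}`. -/
def bCoef {n : ℕ} (Ω : Set (Fin n → ℂ)) (m : ℕ) : ℝ :=
  (sInf ((fun α : Fin n → ℕ => ⨆ z ∈ Ω, ‖mpow z α‖) ''
      {α : Fin n → ℕ | ∑ j, α j = m})) ^ (-(1 / (m : ℝ)))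

section Pluriharmonic

variable {n : ℕ} {H : Type*} [NormedAddCommGroup H] [InnerProductSpace ℂ H] [CompleteSpace H]
  {Y : Type*} [NormedAddCommGroup Y] [NormedSpace ℂ Y]

/-- `f` is a bounded pluriharmonic `B(H)`-valued function on `Ω`, given by coefficient
families `a`, `b` (with `b 0 = 0`): `f = Σ a_α z^α + Σ (b_α)* z̄^α`, both power series
converging locally uniformly on `Ω`, and `f` bounded on `Ω`. -/
def IsBddPluriharmonic (Ω : Set (Fin n → ℂ)) (f : (Fin n → ℂ) → H →L[ℂ] H)
    (a b : (Fin n → ℕ) → H →L[ℂ] H) : Prop :=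
  b 0 = 0 ∧
    (∃ h g : (Fin n → ℂ) → H →L[ℂ] H,
      TendstoLocallyUniformlyOn
        (fun (s : Finset (Fin n → ℕ)) z => ∑ α ∈ s, mpow z α • a α) h atTop Ω ∧
      TendstoLocallyUniformlyOn
        (fun (s : Finset (Fin n → ℕ)) z =>
          ∑ α ∈ s, mpow (star z) α • ContinuousLinearMap.adjoint (b α)) g atTop Ω ∧
      ∀ z ∈ Ω, f z = h z + g z) ∧
    BddAbove ((fun z => ‖f z‖) '' Ω)

/-- The left-hand side `Σ_α sup_{z ∈ rΩ} (‖U a_α‖^p + ‖U b_α‖^p)|z^α|^p` of the second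
Bohr inequality for pluriharmonic functions, valued in `ℝ≥0∞`. -/
def phBohrSum (Ω : Set (Fin n → ℂ)) (r p : ℝ) (U : (H →L[ℂ] H) →L[ℂ] Y)
    (a b : (Fin n → ℕ) → H →L[ℂ] H) : ℝ≥0∞ :=
  ∑' α : Fin n → ℕ, ⨆ z ∈ r • Ω,
    ENNReal.ofReal ((‖U (a α)‖ ^ p + ‖U (b α)‖ ^ p) * ‖mpow z α‖ ^ p)

/-- The second `λ`-powered Bohr radius `L_λ(Ω, p, U)` for pluriharmonic functions. -/
def secondBohrPH (Ω : Set (Fin n → ℂ)) (p lam : ℝ) (U : (H →L[ℂ] H) →L[ℂ] Y) : ℝ :=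
  sSup {r : ℝ | r ∈ Set.Icc (0 : ℝ) 1 ∧
    ∀ (f : (Fin n → ℂ) → H →L[ℂ] H) (a b : (Fin n → ℕ) → H →L[ℂ] H),
      IsBddPluriharmonic Ω f a b →
      phBohrSum Ω r p U a b ≤ ENNReal.ofReal (lam ^ p * supNorm Ω f ^ p)}

end Pluriharmonic

theorem mpow_smul {n : ℕ} (c : ℂ) (z : Fin n → ℂ) (α : Fin n → ℕ) :
    mpow (c • z) α = c ^ (∑ j, α j) * mpow z α := by
  simp [mpow, mul_pow, Finset.prod_mul_distrib, Finset.prod_pow_eq_pow_sum]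

theorem IsCompleteReinhardt.zero_mem {n : ℕ} {Ω : Set (Fin n → ℂ)}
    (h : IsCompleteReinhardt Ω) : (0 : Fin n → ℂ) ∈ Ω := by
  obtain ⟨z, hz⟩ := h.2.1.nonempty
  exact h.2.2 z hz 0 (by simp)

theorem IsCompleteReinhardt.mem_nhds_zero {n : ℕ} {Ω : Set (Fin n → ℂ)}
    (h : IsCompleteReinhardt Ω) : Ω ∈ nhds (0 : Fin n → ℂ) :=
  h.1.mem_nhds h.zero_mem

theorem exists_pos_subset_smul {n : ℕ} {Ω₁ Ω₂ : Set (Fin n → ℂ)}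
    (hb₁ : Bornology.IsBounded Ω₁) (hR₂ : IsCompleteReinhardt Ω₂) :
    {s : ℝ | 0 < s ∧ Ω₁ ⊆ s • Ω₂}.Nonempty := by
  have h := NormedSpace.isVonNBounded_of_isBounded ℝ hb₁
  obtain ⟨s, hs, hsub⟩ := (h hR₂.mem_nhds_zero).exists_pos
  exact ⟨s, hs, hsub s (Real.norm_of_nonneg hs.le).ge⟩

/-- A bounded neighbourhood of the origin is not contained in a strict contraction of itself. -/
theorem one_le_of_subset_smul {E : Type*} [NormedAddCommGroup E] [NormedSpace ℝ E] [Nontrivial E]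
    {Ω : Set E} (h0 : Ω ∈ nhds (0 : E)) (hb : Bornology.IsBounded Ω) {c : ℝ} (hc : 0 ≤ c)
    (h : Ω ⊆ c • Ω) : 1 ≤ c := by
  obtain ⟨C, hC⟩ := isBounded_iff_forall_norm_le.1 hb
  have hbdd : BddAbove (norm '' Ω) := ⟨C, by rintro _ ⟨z, hz, rfl⟩; exact hC z hz⟩
  have hne : Ω.Nonempty := ⟨0, mem_of_mem_nhds h0⟩
  have : (nhdsWithin (0 : E) {0}ᶜ).NeBot := Module.punctured_nhds_neBot ℝ E 0
  obtain ⟨z, hz, hz0⟩ :=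
    nonempty_of_mem (f := nhdsWithin (0 : E) {0}ᶜ)
      (inter_mem (mem_nhdsWithin_of_mem_nhds h0) self_mem_nhdsWithin)
  have hpos : 0 < sSup (norm '' Ω) :=
    (norm_pos_iff.2 hz0).trans_le (le_csSup hbdd ⟨z, hz, rfl⟩)
  have hle : sSup (norm '' Ω) ≤ c * sSup (norm '' Ω) := by
    refine csSup_le (hne.image _) ?_
    rintro _ ⟨w, hw, rfl⟩
    obtain ⟨v, hv, rfl⟩ := h hw
    simp only [norm_smul, Real.norm_of_nonneg hc]
    exact mul_le_mul_of_nonneg_left (le_csSup hbdd ⟨v, hv, rfl⟩) hc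
  exact le_of_mul_le_mul_right (by simpa using hle) hpos

theorem supNorm_nonneg {n : ℕ} {E : Type*} [NormedAddCommGroup E] (Ω : Set (Fin n → ℂ))
    (f : (Fin n → ℂ) → E) : 0 ≤ supNorm Ω f :=
  Real.iSup_nonneg fun _ => Real.iSup_nonneg fun _ => norm_nonneg _

theorem norm_le_supNorm {n : ℕ} {E : Type*} [NormedAddCommGroup E] {Ω : Set (Fin n → ℂ)}
    {f : (Fin n → ℂ) → E} (hf : BddAbove ((fun z => ‖f z‖) '' Ω)) {z : Fin n → ℂ} (hz : z ∈ Ω) :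
    ‖f z‖ ≤ supNorm Ω f := by
  obtain ⟨C, hC⟩ := hf
  have hbdd : BddAbove (Set.range fun z => ⨆ _ : z ∈ Ω, ‖f z‖) := by
    refine ⟨max C 0, ?_⟩
    rintro _ ⟨w, rfl⟩
    exact Real.iSup_le (fun hw => (hC ⟨w, hw, rfl⟩).trans (le_max_left _ _)) (le_max_right _ _)
  refine le_trans ?_ (le_ciSup hbdd z)
  simp [hz]

theorem supNorm_le {n : ℕ} {E : Type*} [NormedAddCommGroup E] {Ω : Set (Fin n → ℂ)}
    {f : (Fin n → ℂ) → E} {C : ℝ} (hC : 0 ≤ C) (h : ∀ z ∈ Ω, ‖f z‖ ≤ C) : supNorm Ω f ≤ C :=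
  Real.iSup_le (fun z => Real.iSup_le (h z) hC) hC

section Comparison

variable {n : ℕ} {H : Type*} [NormedAddCommGroup H] [InnerProductSpace ℂ H] [CompleteSpace H]
  {Y : Type*} [NormedAddCommGroup Y] [NormedSpace ℂ Y]

/-- `r` is admissible in the definition of the second Bohr radius. -/
def IsBohrAdmissible (Ω : Set (Fin n → ℂ)) (p lam : ℝ) (U : (H →L[ℂ] H) →L[ℂ] Y) (r : ℝ) : Prop :=
  r ∈ Set.Icc (0 : ℝ) 1 ∧
    ∀ (f : (Fin n → ℂ) → H →L[ℂ] H) (a b : (Fin n → ℕ) → H →L[ℂ] H),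
      IsBddPluriharmonic Ω f a b →
      phBohrSum Ω r p U a b ≤ ENNReal.ofReal (lam ^ p * supNorm Ω f ^ p)

/-- Composition of a bounded pluriharmonic function with a dilation. -/
theorem IsBddPluriharmonic.comp_smul {Ω₁ Ω₂ : Set (Fin n → ℂ)} {f : (Fin n → ℂ) → H →L[ℂ] H}
    {a b : (Fin n → ℕ) → H →L[ℂ] H} (hf : IsBddPluriharmonic Ω₁ f a b) {c : ℝ}
    (hc : ∀ z ∈ Ω₂, (c : ℂ) • z ∈ Ω₁) :
    IsBddPluriharmonic Ω₂ (fun z => f ((c : ℂ) • z))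
      (fun α => (c : ℂ) ^ (∑ j, α j) • a α) (fun α => (c : ℂ) ^ (∑ j, α j) • b α) := by
  obtain ⟨hb0, ⟨h, g, hh, hg, hfz⟩, C, hC⟩ := hf
  have hcont : ContinuousOn (fun z : Fin n → ℂ => (c : ℂ) • z) Ω₂ := by fun_prop
  refine ⟨by simp [hb0], ⟨fun z => h ((c : ℂ) • z), fun z => g ((c : ℂ) • z), ?_, ?_,
    fun z hz => hfz _ (hc z hz)⟩, C, ?_⟩
  · convert hh.comp _ hc hcont using 3 with s z <;> try rfl
    refine Finset.sum_congr rfl fun α _ => ?_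
    rw [mpow_smul, smul_smul, mul_comm]
  · convert hg.comp _ hc hcont using 3 with s z <;> try rfl
    refine Finset.sum_congr rfl fun α _ => ?_
    rw [star_smul, mpow_smul, map_smulₛₗ, smul_smul, mul_comm]
    simp
  · rintro _ ⟨z, hz, rfl⟩
    exact hC ⟨_, hc z hz, rfl⟩

theorem isBohrAdmissible_zero {Ω : Set (Fin n → ℂ)} (h0 : (0 : Fin n → ℂ) ∈ Ω) {p lam : ℝ}
    (hp : 1 ≤ p) (U : (H →L[ℂ] H) →L[ℂ] Y) (hU : ‖U‖ ≤ lam) :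
    IsBohrAdmissible Ω p lam U 0 := by
  refine ⟨by simp, fun f a b hf => ?_⟩
  have hp0 : p ≠ 0 := by positivity
  have hlam : 0 ≤ lam := (norm_nonneg U).trans hU
  have hmp : ∀ α : Fin n → ℕ, α ≠ 0 → mpow (0 : Fin n → ℂ) α = 0 := fun α hα => by
    obtain ⟨j, hj⟩ := Function.ne_iff.1 hα
    exact Finset.prod_eq_zero (Finset.mem_univ j) (by simpa using hj)
  have hf0 : f 0 = a 0 := by
    obtain ⟨hb0, ⟨h, g, hh, hg, hfz⟩, -⟩ := hf
    have key : ∀ (d : (Fin n → ℕ) → H →L[ℂ] H) (x : H →L[ℂ] H),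
        Tendsto (fun s : Finset (Fin n → ℕ) => ∑ α ∈ s, mpow (0 : Fin n → ℂ) α • d α) atTop
          (nhds x) → x = d 0 := fun d x hx => by
      have hsum : HasSum (fun α => mpow (0 : Fin n → ℂ) α • d α) x := by
        simpa only [HasSum, SummationFilter.unconditional_filter] using hx
      rw [hsum.unique (hasSum_single 0 fun α hα => by simp [hmp α hα])]
      simp [mpow]
    rw [hfz 0 h0, key a _ (hh.tendsto_at h0),
      key (fun α => ContinuousLinearMap.adjoint (b α)) (g 0) (by simpa using hg.tendsto_at h0)]
    simp [hb0]
  have hz : (0 : ℝ) • Ω = {0} := Set.zero_smul_set ⟨0, h0⟩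
  rw [phBohrSum, hz, tsum_eq_single 0 (fun α hα => by simp [hmp α hα, Real.zero_rpow hp0])]
  simp only [Set.mem_singleton_iff, iSup_iSup_eq_left]
  refine ENNReal.ofReal_le_ofReal ?_
  rw [hf.1, map_zero, norm_zero, Real.zero_rpow hp0]
  simp only [mpow, Pi.zero_apply, pow_zero, Finset.prod_const_one, norm_one, Real.one_rpow, add_zero,
    mul_one]
  rw [← Real.mul_rpow hlam (supNorm_nonneg _ _)]
  refine Real.rpow_le_rpow (norm_nonneg _) ?_ (by positivity)
  refine (U.le_opNorm _).trans ?_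
  rw [← hf0]
  exact mul_le_mul hU (norm_le_supNorm hf.2.2 h0) (norm_nonneg _) hlam

theorem IsBohrAdmissible.div {Ω₁ Ω₂ : Set (Fin n → ℂ)} {p lam : ℝ} (hp : 1 ≤ p)
    {U : (H →L[ℂ] H) →L[ℂ] Y} (hlam : 0 ≤ lam) {r s t : ℝ} (hs : 0 < s) (ht : 0 < t)
    (hst : 1 ≤ s * t) (h₁₂ : Ω₁ ⊆ s • Ω₂) (h₂₁ : Ω₂ ⊆ t • Ω₁)
    (hr : IsBohrAdmissible Ω₂ p lam U r) : IsBohrAdmissible Ω₁ p lam U (r / (s * t)) := by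
  obtain ⟨⟨hr0, hr1⟩, hr⟩ := hr
  refine ⟨⟨by positivity, div_le_one_of_le₀ (hr1.trans hst) (by positivity)⟩, fun f a b hf => ?_⟩
  have hc : ∀ z ∈ Ω₂, ((t⁻¹ : ℝ) : ℂ) • z ∈ Ω₁ := fun z hz => by
    obtain ⟨w, hw, rfl⟩ := h₂₁ hz
    convert hw using 1
    ext j
    simp [ht.ne']
  refine le_trans ?_ ((hr _ _ _ (hf.comp_smul hc)).trans (ENNReal.ofReal_le_ofReal ?_))
  · refine ENNReal.tsum_le_tsum fun α => iSup₂_le ?_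
    rintro _ ⟨w, hw, rfl⟩
    obtain ⟨v, hv, rfl⟩ := h₁₂ hw
    refine le_iSup₂_of_le (r • v) (Set.smul_mem_smul_set hv) (le_of_eq ?_)
    have hz : (r / (s * t)) • s • v = ((t⁻¹ : ℝ) : ℂ) • r • v := by
      ext j
      have hs0 : (s : ℂ) ≠ 0 := by exact_mod_cast hs.ne'
      simp
      field_simp
    simp only [hz, mpow_smul, map_smul, norm_smul, norm_mul]
    rw [Real.mul_rpow (norm_nonneg _) (norm_nonneg _),
      Real.mul_rpow (norm_nonneg _) (norm_nonneg _), Real.mul_rpow (norm_nonneg _) (norm_nonneg _)]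
    congr 1
    ring
  · have hle : supNorm Ω₂ (fun z => f (((t⁻¹ : ℝ) : ℂ) • z)) ≤ supNorm Ω₁ f :=
      supNorm_le (supNorm_nonneg _ _) fun z hz => norm_le_supNorm hf.2.2 (hc z hz)
    exact mul_le_mul_of_nonneg_left
      (Real.rpow_le_rpow (supNorm_nonneg _ _) hle (by positivity)) (Real.rpow_nonneg hlam p)

theorem secondBohrPH_nonneg (Ω : Set (Fin n → ℂ)) (p lam : ℝ) (U : (H →L[ℂ] H) →L[ℂ] Y) :
    0 ≤ secondBohrPH Ω p lam U :=
  Real.sSup_nonneg fun _ hr => hr.1.1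

theorem secondBohrPH_le_SRatio_mul (hn : 1 ≤ n) {Ω₁ Ω₂ : Set (Fin n → ℂ)}
    (hR₁ : IsCompleteReinhardt Ω₁) (hR₂ : IsCompleteReinhardt Ω₂)
    (hb₁ : Bornology.IsBounded Ω₁) (hb₂ : Bornology.IsBounded Ω₂)
    (U : (H →L[ℂ] H) →L[ℂ] Y) {p lam : ℝ} (hp : 1 ≤ p) (hU : ‖U‖ ≤ lam) :
    secondBohrPH Ω₂ p lam U ≤ SRatio Ω₁ Ω₂ * SRatio Ω₂ Ω₁ * secondBohrPH Ω₁ p lam U := by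
  have : Nonempty (Fin n) := ⟨⟨0, hn⟩⟩
  have hL := secondBohrPH_nonneg Ω₁ p lam U
  have key : ∀ s ∈ {s : ℝ | 0 < s ∧ Ω₁ ⊆ s • Ω₂}, ∀ t ∈ {t : ℝ | 0 < t ∧ Ω₂ ⊆ t • Ω₁},
      secondBohrPH Ω₂ p lam U ≤ s * t * secondBohrPH Ω₁ p lam U := by
    rintro s ⟨hs, h₁₂⟩ t ⟨ht, h₂₁⟩
    have hst : 1 ≤ s * t := by
      refine one_le_of_subset_smul hR₁.mem_nhds_zero hb₁ (by positivity) ?_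
      rw [mul_smul]
      exact h₁₂.trans (Set.smul_set_mono h₂₁)
    refine csSup_le ⟨0, isBohrAdmissible_zero hR₂.zero_mem hp U hU⟩ fun r hr => ?_
    rw [← div_le_iff₀' (by positivity)]
    exact le_csSup ⟨1, fun r hr => hr.1.2⟩
      (IsBohrAdmissible.div hp ((norm_nonneg U).trans hU) hs ht hst h₁₂ h₂₁ hr)
  have hS : 0 ≤ SRatio Ω₂ Ω₁ := Real.sInf_nonneg fun _ h => h.1.le
  have hstep : ∀ s ∈ {s : ℝ | 0 < s ∧ Ω₁ ⊆ s • Ω₂},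
      secondBohrPH Ω₂ p lam U ≤ s * SRatio Ω₂ Ω₁ * secondBohrPH Ω₁ p lam U := fun s hs => by
    rw [mul_right_comm, SRatio, ← smul_eq_mul,
      ← Real.sInf_smul_of_nonneg (mul_nonneg hs.1.le hL)]
    refine le_csInf (exists_pos_subset_smul hb₂ hR₁).smul_set ?_
    rintro _ ⟨t, ht, rfl⟩
    simpa only [smul_eq_mul, mul_right_comm] using key s hs t ht
  rw [mul_assoc, mul_comm, SRatio.eq_1 Ω₁, ← smul_eq_mul,
    ← Real.sInf_smul_of_nonneg (mul_nonneg hS hL)]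
  refine le_csInf (exists_pos_subset_smul hb₁ hR₂).smul_set ?_
  rintro _ ⟨s, hs, rfl⟩
  simpa only [smul_eq_mul, mul_comm, mul_assoc, mul_left_comm] using hstep s hs

end Comparison

/-- comparison of second Bohr radii of two bounded simply connected complete
Reinhardt domains (Lemma 3.5). -/
theorem second_bohr_PH_domain_comparison {n : ℕ} (hn : 1 ≤ n)
    (Ω₁ Ω₂ : Set (Fin n → ℂ))
    (hR₁ : IsCompleteReinhardt Ω₁) (hR₂ : IsCompleteReinhardt Ω₂)
    (hb₁ : Bornology.IsBounded Ω₁) (hb₂ : Bornology.IsBounded Ω₂)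
    (hs₁ : SimplyConnectedSpace Ω₁) (hs₂ : SimplyConnectedSpace Ω₂)
    {H : Type*} [NormedAddCommGroup H] [InnerProductSpace ℂ H] [CompleteSpace H]
    {Y : Type*} [NormedAddCommGroup Y] [NormedSpace ℂ Y] [CompleteSpace Y]
    (U : (H →L[ℂ] H) →L[ℂ] Y) (p lam : ℝ) (hp : 1 ≤ p) (hU : ‖U‖ ≤ lam) :
    secondBohrPH Ω₂ p lam U / (SRatio Ω₁ Ω₂ * SRatio Ω₂ Ω₁) ≤ secondBohrPH Ω₁ p lam U ∧
      secondBohrPH Ω₁ p lam U ≤ SRatio Ω₁ Ω₂ * SRatio Ω₂ Ω₁ * secondBohrPH Ω₂ p lam U := by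
  have h₂₁ := secondBohrPH_le_SRatio_mul hn hR₁ hR₂ hb₁ hb₂ U hp hU
  have h₁₂ := secondBohrPH_le_SRatio_mul hn hR₂ hR₁ hb₂ hb₁ U hp hU
  refine ⟨div_le_of_le_mul₀ ?_ (secondBohrPH_nonneg _ _ _ _) (by rwa [mul_comm]), ?_⟩
  · exact mul_nonneg (Real.sInf_nonneg fun _ h => h.1.le) (Real.sInf_nonneg fun _ h => h.1.le)
  · rwa [mul_comm (SRatio Ω₁ Ω₂)]

end BohrPaper
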